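/- Let G = (V,E,Ω) be a finite connected graph whose vertex set V is a finite subset of ℝⁿ with adjacent vertices distinct as points of ℝⁿ, let Ω ⊆ V be nonempty, and let f : Ω → ℝᵐ. Then there exists a unique tight extension u of f on G; moreover u is tighter than every other extension v of f (v ≠ u). -/

import Mathlib

/-- Local Lipschitz constant of `v` at `x` with respect to the graph with vertex set `V`
and adjacency relation `Adj`: `Lv(x) = max_{y ∈ S(x)} ‖v y - v x‖ / ‖y - x‖`
(with `sSup ∅ = 0` by the junk-value convention of `Real.sSup`). -/
noncomputable def locLip {n m : ℕ} (V : Finset (EuclideanSpace ℝ (Fin n)))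
    (Adj : EuclideanSpace ℝ (Fin n) → EuclideanSpace ℝ (Fin n) → Prop)
    (v : EuclideanSpace ℝ (Fin n) → EuclideanSpace ℝ (Fin m))
    (x : EuclideanSpace ℝ (Fin n)) : ℝ :=
  sSup {r : ℝ | ∃ y ∈ V, Adj x y ∧ r = ‖v y - v x‖ / ‖y - x‖}

/-- `v` is tighter than `u`:
`max{Lu(x) : x ∈ V \ Ω, Lu(x) > Lv(x)} > max{Lv(x) : x ∈ V \ Ω, Lv(x) > Lu(x)}`,
with the convention that the max over the empty set is `0` (`Real.sSup ∅ = 0`). -/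
noncomputable def Tighter {n m : ℕ} (V Ω : Finset (EuclideanSpace ℝ (Fin n)))
    (Adj : EuclideanSpace ℝ (Fin n) → EuclideanSpace ℝ (Fin n) → Prop)
    (v u : EuclideanSpace ℝ (Fin n) → EuclideanSpace ℝ (Fin m)) : Prop :=
  sSup {r : ℝ | ∃ x ∈ V, x ∉ Ω ∧ locLip V Adj v x < locLip V Adj u x ∧ r = locLip V Adj u x} >
  sSup {r : ℝ | ∃ x ∈ V, x ∉ Ω ∧ locLip V Adj u x < locLip V Adj v x ∧ r = locLip V Adj v x}

open Filter Topology

/-- The `k`-th largest value of `g` on `s`. -/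
noncomputable def orderStat {α : Type*} (s : Finset α) (k : ℕ) (g : α → ℝ) : EReal :=
  (s.powersetCard k).sup fun S => S.inf fun x => (g x : EReal)

lemma inf_le_orderStat {α : Type*} {s S : Finset α} {k : ℕ} (g : α → ℝ)
    (hS : S ∈ s.powersetCard k) : (S.inf fun x => (g x : EReal)) ≤ orderStat s k g :=
  Finset.le_sup (f := fun S : Finset α => S.inf fun x => (g x : EReal)) hS

lemma continuous_orderStat {X α : Type*} [TopologicalSpace X] (s : Finset α) (k : ℕ)
    (g : X → α → ℝ) (hg : ∀ x ∈ s, Continuous fun p => g p x) :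
    Continuous fun p => orderStat s k (g p) := by
  unfold orderStat
  refine Continuous.finset_sup_apply fun S hS => Continuous.finset_inf_apply fun x hx => ?_
  exact continuous_coe_real_ereal.comp (hg x ((Finset.mem_powersetCard.1 hS).1 hx))

/-- A finite sequence of continuous functions has a lexicographic minimizer on a compact set. -/
lemma IsCompact.exists_lex_min {X Y : Type*} [TopologicalSpace X] [LinearOrder Y]
    [TopologicalSpace Y] [OrderClosedTopology Y] (N : ℕ) :
    ∀ {K : Set X}, IsCompact K → K.Nonempty → ∀ c : ℕ → X → Y, (∀ k, Continuous (c k)) →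
      ∃ u ∈ K, ∀ w ∈ K, ∀ k < N, (∀ j < k, c j w ≤ c j u) → c k u ≤ c k w := by
  induction N with
  | zero =>
    rintro K - ⟨u, hu⟩ c -
    exact ⟨u, hu, fun w _ k hk => absurd hk k.not_lt_zero⟩
  | succ N ih =>
    intro K hK hK0 c hc
    obtain ⟨u₀, hu₀, hmin⟩ := hK.exists_isMinOn hK0 (hc 0).continuousOn
    obtain ⟨u, hu, h⟩ := ih (hK.inter_right (isClosed_le (hc 0) continuous_const))
      ⟨u₀, hu₀, le_refl (c 0 u₀)⟩ (fun k => c (k + 1)) fun k => hc (k + 1)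
    refine ⟨u, hu.1, fun w hw k hk hj => ?_⟩
    rcases k with _ | k
    · exact le_trans hu.2 (hmin hw)
    · exact h w ⟨hw, (hj 0 k.succ_pos).trans hu.2⟩ k (by omega)
        fun j hjk => hj (j + 1) (by omega)

/-- `h` improves on `g` over `s`: above some level it is nowhere larger and somewhere smaller,
and below this level it stays below. -/
def Improves {α : Type*} (s : Finset α) (h g : α → ℝ) : Prop :=
  ∃ M : ℝ, (∀ x ∈ s, M ≤ g x → h x ≤ g x) ∧ (∀ x ∈ s, g x < M → h x < M) ∧
    ∃ x ∈ s, M ≤ g x ∧ h x < g x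

lemma Improves.exists_orderStat_lt {α : Type*} {s : Finset α} {h g : α → ℝ}
    (H : Improves s h g) :
    ∃ k < s.card + 1, (∀ j < k, orderStat s j h ≤ orderStat s j g) ∧
      orderStat s k h < orderStat s k g := by
  classical
  obtain ⟨M, hge, hlt, x₀, hx₀, hM, hx₀lt⟩ := H
  set a := g x₀ with ha
  have key : ∀ x ∈ s, a ≤ h x → h x ≤ g x := by
    intro x hx hax
    by_contra hgt
    rcases le_or_gt M (g x) with h1 | h1
    · exact hgt (hge x hx h1)
    · linarith [hlt x hx h1]
  set U := s.filter fun x => a ≤ g x with hU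
  have hUle : ∀ S ⊆ U, (a : EReal) ≤ S.inf fun x => (g x : EReal) := fun S hS =>
    Finset.le_inf fun x hx => EReal.coe_le_coe_iff.2 (Finset.mem_filter.1 (hS hx)).2
  have hge' : ∀ j ≤ U.card, (a : EReal) ≤ orderStat s j g := by
    intro j hj
    obtain ⟨S, hSU, hSc⟩ := Finset.exists_subset_card_eq hj
    refine (hUle S hSU).trans (inf_le_orderStat g ?_)
    exact Finset.mem_powersetCard.2 ⟨hSU.trans (Finset.filter_subset _ _), hSc⟩
  refine ⟨U.card, Nat.lt_succ_of_le (Finset.card_le_card (Finset.filter_subset _ _)), ?_, ?_⟩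
  · intro j hj
    refine Finset.sup_le fun S hS => ?_
    have hS' := Finset.mem_powersetCard.1 hS
    rcases le_or_gt (S.inf fun x => (h x : EReal)) a with h1 | h1
    · exact h1.trans (hge' j hj.le)
    · refine le_trans (Finset.le_inf fun x hx => ?_)
        (inf_le_orderStat g hS)
      have h2 : (S.inf fun x => (h x : EReal)) ≤ h x := Finset.inf_le hx
      exact h2.trans (EReal.coe_le_coe_iff.2
        (key x (hS'.1 hx) (EReal.coe_le_coe_iff.1 (h1.le.trans h2))))
  · refine lt_of_lt_of_le ?_ (hge' _ le_rfl)
    refine (Finset.sup_lt_iff (EReal.bot_lt_coe a)).2 fun S hS => ?_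
    have hS' := Finset.mem_powersetCard.1 hS
    by_contra hcon
    have h1 : ∀ x ∈ S, a ≤ h x := fun x hx =>
      EReal.coe_le_coe_iff.1 ((not_lt.1 hcon).trans (Finset.inf_le hx))
    have hSU : S ⊆ U := fun x hx => Finset.mem_filter.2
      ⟨hS'.1 hx, (h1 x hx).trans (key x (hS'.1 hx) (h1 x hx))⟩
    have hEq : S = U := Finset.eq_of_subset_of_card_le hSU hS'.2.ge
    have : x₀ ∈ S := hEq ▸ Finset.mem_filter.2 ⟨hx₀, le_rfl⟩
    linarith [h1 x₀ this]

section LocLip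

variable {n m : ℕ} {V Ω : Finset (EuclideanSpace ℝ (Fin n))}
  {Adj : EuclideanSpace ℝ (Fin n) → EuclideanSpace ℝ (Fin n) → Prop}
  {u v w f : EuclideanSpace ℝ (Fin n) → EuclideanSpace ℝ (Fin m)}
  {x y : EuclideanSpace ℝ (Fin n)} {M : ℝ}

lemma finite_slopes : {r : ℝ | ∃ y ∈ V, Adj x y ∧ r = ‖v y - v x‖ / ‖y - x‖}.Finite :=
  (V.finite_toSet.image fun y => ‖v y - v x‖ / ‖y - x‖).subset
    (by rintro r ⟨y, hy, -, rfl⟩; exact ⟨y, hy, rfl⟩)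

lemma slope_le_locLip (hy : y ∈ V) (h : Adj x y) :
    ‖v y - v x‖ / ‖y - x‖ ≤ locLip V Adj v x :=
  le_csSup finite_slopes.bddAbove ⟨y, hy, h, rfl⟩

lemma locLip_nonneg : 0 ≤ locLip V Adj v x :=
  Real.sSup_nonneg (by rintro r ⟨y, -, -, rfl⟩; positivity)

lemma locLip_le (hM : 0 ≤ M) (h : ∀ y ∈ V, Adj x y → ‖v y - v x‖ / ‖y - x‖ ≤ M) :
    locLip V Adj v x ≤ M :=
  Real.sSup_le (by rintro r ⟨y, hy, hxy, rfl⟩; exact h y hy hxy) hM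

lemma locLip_lt (hM : 0 < M) (h : ∀ y ∈ V, Adj x y → ‖v y - v x‖ / ‖y - x‖ < M) :
    locLip V Adj v x < M := by
  rcases Set.eq_empty_or_nonempty
    {r : ℝ | ∃ y ∈ V, Adj x y ∧ r = ‖v y - v x‖ / ‖y - x‖} with h0 | h0
  · rw [locLip, h0, Real.sSup_empty]; exact hM
  · obtain ⟨y, hy, hxy, hr⟩ := h0.csSup_mem finite_slopes
    rw [locLip, hr]; exact h y hy hxy

lemma locLip_congr (hx : x ∈ V) (h : ∀ y ∈ V, u y = v y) :
    locLip V Adj u x = locLip V Adj v x := by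
  unfold locLip
  congr 1
  ext r
  refine exists_congr fun y => and_congr_right fun hy => ?_
  rw [h y hy, h x hx]

lemma continuous_locLip : Continuous fun v : EuclideanSpace ℝ (Fin n) →
    EuclideanSpace ℝ (Fin m) => locLip V Adj v x := by
  classical
  rcases (V.filter (Adj x)).eq_empty_or_nonempty with h0 | h0
  · have : ∀ v : EuclideanSpace ℝ (Fin n) → EuclideanSpace ℝ (Fin m), locLip V Adj v x = 0 := by
      intro v
      refine le_antisymm (locLip_le le_rfl fun y hy hxy => ?_) locLip_nonneg
      exact absurd (Finset.mem_filter.2 ⟨hy, hxy⟩) (h0 ▸ Finset.notMem_empty y)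
    simpa only [this] using continuous_const
  · have : ∀ v : EuclideanSpace ℝ (Fin n) → EuclideanSpace ℝ (Fin m), locLip V Adj v x =
        (V.filter (Adj x)).sup' h0 fun y => ‖v y - v x‖ / ‖y - x‖ := by
      intro v
      refine le_antisymm (csSup_le ?_ ?_) (Finset.sup'_le _ _ fun y hy => ?_)
      · obtain ⟨y, hy⟩ := h0
        exact ⟨_, y, (Finset.mem_filter.1 hy).1, (Finset.mem_filter.1 hy).2, rfl⟩
      · rintro r ⟨y, hy, hxy, rfl⟩
        exact Finset.le_sup' (fun y => ‖v y - v x‖ / ‖y - x‖) (Finset.mem_filter.2 ⟨hy, hxy⟩)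
      · exact slope_le_locLip (Finset.mem_filter.1 hy).1 (Finset.mem_filter.1 hy).2
    simp only [this]
    exact Continuous.finset_sup'_apply h0 fun y _ => by fun_prop

lemma slope_midpoint_le :
    ‖midpoint ℝ (u y) (v y) - midpoint ℝ (u x) (v x)‖ / ‖y - x‖ ≤
      (‖u y - u x‖ / ‖y - x‖ + ‖v y - v x‖ / ‖y - x‖) / 2 := by
  have h : midpoint ℝ (u y) (v y) - midpoint ℝ (u x) (v x) =
      (2⁻¹ : ℝ) • ((u y - u x) + (v y - v x)) := by
    simp only [midpoint_eq_smul_add, invOf_eq_inv]; module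
  rw [h, norm_smul, ← add_div, div_right_comm]
  gcongr
  have := norm_add_le (u y - u x) (v y - v x)
  norm_num
  linarith

lemma slope_midpoint_lt (hxy : x ≠ y) (hu : ‖u y - u x‖ / ‖y - x‖ ≤ M)
    (hv : ‖v y - v x‖ / ‖y - x‖ ≤ M) (huv : u y - u x ≠ v y - v x) :
    ‖midpoint ℝ (u y) (v y) - midpoint ℝ (u x) (v x)‖ / ‖y - x‖ < M := by
  have hpos : 0 < ‖y - x‖ := norm_pos_iff.2 (sub_ne_zero.2 hxy.symm)
  have h : midpoint ℝ (u y) (v y) - midpoint ℝ (u x) (v x) =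
      (2⁻¹ : ℝ) • (u y - u x) + (2⁻¹ : ℝ) • (v y - v x) := by
    simp only [midpoint_eq_smul_add, invOf_eq_inv]; module
  rw [div_le_iff₀ hpos] at hu hv
  rw [div_lt_iff₀ hpos, h]
  exact norm_combo_lt_of_ne hu hv huv (by norm_num) (by norm_num) (by norm_num)

lemma locLip_midpoint_le : locLip V Adj (fun z => midpoint ℝ (u z) (v z)) x ≤
    (locLip V Adj u x + locLip V Adj v x) / 2 := by
  have hu : 0 ≤ locLip V Adj u x := locLip_nonneg
  have hv : 0 ≤ locLip V Adj v x := locLip_nonneg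
  refine locLip_le (by linarith) fun y hy hxy => ?_
  refine slope_midpoint_le.trans ?_
  linarith [slope_le_locLip (v := u) hy hxy, slope_le_locLip (v := v) hy hxy]

/-- Extensions of `f` with bounded local Lipschitz constants are bounded at every vertex. -/
lemma exists_norm_bound (hsymm : ∀ x y, Adj x y → Adj y x) (hne : ∀ x y, Adj x y → x ≠ y)
    (hconn : ∀ x ∈ V, ∀ y ∈ V,
      Relation.ReflTransGen (fun a b => a ∈ V ∧ b ∈ V ∧ Adj a b) x y)
    (hΩ : Ω.Nonempty) (hΩV : Ω ⊆ V) (C : ℝ) (hy : y ∈ V) :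
    ∃ R : ℝ, ∀ u : EuclideanSpace ℝ (Fin n) → EuclideanSpace ℝ (Fin m),
      (∀ z ∈ Ω, u z = f z) → (∀ x ∈ V \ Ω, locLip V Adj u x ≤ C) → ‖u y‖ ≤ R := by
  obtain ⟨z, hz⟩ := hΩ
  have hzy := hconn z (hΩV hz) y hy
  clear hy
  induction hzy with
  | refl => exact ⟨‖f z‖, fun u hu _ => by rw [hu z hz]⟩
  | @tail a b _ hab ih =>
    obtain ⟨ha, hb, hadj⟩ := hab
    obtain ⟨R, hR⟩ := ih
    by_cases hbΩ : b ∈ Ω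
    · exact ⟨‖f b‖, fun u hu _ => by rw [hu b hbΩ]⟩
    · refine ⟨R + C * ‖a - b‖, fun u hu hC => ?_⟩
      have h1 := (slope_le_locLip (v := u) ha (hsymm _ _ hadj)).trans
        (hC b (Finset.mem_sdiff.2 ⟨hb, hbΩ⟩))
      rw [div_le_iff₀ (norm_pos_iff.2 (sub_ne_zero.2 (hne _ _ hadj)))] at h1
      have h2 := norm_sub_norm_le (u b) (u a)
      rw [norm_sub_rev] at h2
      linarith [hR u hu hC]

/-- There is an extension which admits no improvement. -/
lemma exists_extension_not_improves (hsymm : ∀ x y, Adj x y → Adj y x)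
    (hne : ∀ x y, Adj x y → x ≠ y)
    (hconn : ∀ x ∈ V, ∀ y ∈ V,
      Relation.ReflTransGen (fun a b => a ∈ V ∧ b ∈ V ∧ Adj a b) x y)
    (hΩ : Ω.Nonempty) (hΩV : Ω ⊆ V)
    (f : EuclideanSpace ℝ (Fin n) → EuclideanSpace ℝ (Fin m)) :
    ∃ u : EuclideanSpace ℝ (Fin n) → EuclideanSpace ℝ (Fin m), (∀ z ∈ Ω, u z = f z) ∧
      ∀ w : EuclideanSpace ℝ (Fin n) → EuclideanSpace ℝ (Fin m), (∀ z ∈ Ω, w z = f z) →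
        ¬ Improves (V \ Ω) (locLip V Adj w) (locLip V Adj u) := by
  classical
  obtain ⟨C, hC⟩ : ∃ C, ∀ x ∈ V \ Ω, locLip V Adj f x ≤ C :=
    ((V \ Ω).finite_toSet.image (locLip V Adj f)).bddAbove.imp
      fun C h x hx => h ⟨x, hx, rfl⟩
  have hb := fun y (hy : y ∈ V) =>
    exists_norm_bound (m := m) (f := f) hsymm hne hconn hΩ hΩV C hy
  choose! R hR using hb
  set K : Set (EuclideanSpace ℝ (Fin n) → EuclideanSpace ℝ (Fin m)) :=
    {u | (∀ z, z ∉ V \ Ω → u z = f z) ∧ ∀ x ∈ V \ Ω, locLip V Adj u x ≤ C} with hK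
  have hclosed : IsClosed K := by
    have : K = (⋂ z, ⋂ (_ : z ∉ V \ Ω), {u | u z = f z}) ∩
        ⋂ x, ⋂ (_ : x ∈ V \ Ω), {u | locLip V Adj u x ≤ C} := by
      ext u; simp only [hK, Set.mem_inter_iff, Set.mem_iInter, Set.mem_ofPred_eq]
    rw [this]
    refine IsClosed.inter (isClosed_iInter fun z => isClosed_iInter fun _ => ?_)
      (isClosed_iInter fun x => isClosed_iInter fun _ => ?_)
    · exact isClosed_eq (continuous_apply z) continuous_const
    · exact isClosed_le continuous_locLip continuous_const
  have hcompact : IsCompact K := by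
    refine (isCompact_univ_pi fun z => isCompact_closedBall
      (0 : EuclideanSpace ℝ (Fin m)) (max (R z) ‖f z‖)).of_isClosed_subset hclosed ?_
    intro u hu z _
    rw [mem_closedBall_zero_iff]
    by_cases hz : z ∈ V \ Ω
    · exact (hR z (Finset.mem_sdiff.1 hz).1 u
        (fun y hy => hu.1 y fun h => (Finset.mem_sdiff.1 h).2 hy) hu.2).trans (le_max_left _ _)
    · rw [hu.1 z hz]; exact le_max_right _ _
  obtain ⟨u, huK, hmin⟩ := hcompact.exists_lex_min ((V \ Ω).card + 1) ⟨f, fun _ _ => rfl, hC⟩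
    (fun k u => orderStat (V \ Ω) k (locLip V Adj u))
    fun k => continuous_orderStat _ k _ fun x _ => continuous_locLip
  refine ⟨u, fun z hz => huK.1 z fun h => (Finset.mem_sdiff.1 h).2 hz, fun w hw himp => ?_⟩
  set w' : EuclideanSpace ℝ (Fin n) → EuclideanSpace ℝ (Fin m) :=
    fun z => if z ∈ V then w z else f z with hw'
  have hww' : ∀ x ∈ V \ Ω, locLip V Adj w' x = locLip V Adj w x := fun x hx =>
    locLip_congr (Finset.mem_sdiff.1 hx).1 fun y hy => if_pos hy
  have himp' : Improves (V \ Ω) (locLip V Adj w') (locLip V Adj u) := by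
    obtain ⟨M, h1, h2, x, hx, h3⟩ := himp
    exact ⟨M, fun x hx => hww' x hx ▸ h1 x hx, fun x hx => hww' x hx ▸ h2 x hx, x, hx,
      hww' x hx ▸ h3⟩
  have hwK : w' ∈ K := by
    refine ⟨fun z hz => ?_, fun x hx => ?_⟩
    · by_cases hzV : z ∈ V
      · have : z ∈ Ω := by
          by_contra h
          exact hz (Finset.mem_sdiff.2 ⟨hzV, h⟩)
        rw [hw']; simp only [if_pos hzV, hw z this]
      · exact if_neg hzV
    · obtain ⟨M, h1, h2, y, hy, h3, -⟩ := himp'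
      rcases le_or_gt M (locLip V Adj u x) with h | h
      · exact (h1 x hx h).trans (huK.2 x hx)
      · exact (h2 x hx h).le.trans (h3.trans (huK.2 y hy))
  obtain ⟨k, hk, hj, hlt⟩ := himp'.exists_orderStat_lt
  exact absurd (hmin w' hwK k hk hj) (not_le.2 hlt)

/-- Two extensions with the same local Lipschitz constants agree, if one of them admits no
improvement. -/
lemma eq_of_locLip_eq (hsymm : ∀ x y, Adj x y → Adj y x) (hne : ∀ x y, Adj x y → x ≠ y)
    (hconn : ∀ x ∈ V, ∀ y ∈ V,
      Relation.ReflTransGen (fun a b => a ∈ V ∧ b ∈ V ∧ Adj a b) x y)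
    (hΩ : Ω.Nonempty) (hΩV : Ω ⊆ V) (hu : ∀ z ∈ Ω, u z = f z) (hv : ∀ z ∈ Ω, v z = f z)
    (hmin : ∀ w : EuclideanSpace ℝ (Fin n) → EuclideanSpace ℝ (Fin m), (∀ z ∈ Ω, w z = f z) →
      ¬ Improves (V \ Ω) (locLip V Adj w) (locLip V Adj u))
    (huv : ∀ x ∈ V \ Ω, locLip V Adj u x = locLip V Adj v x) : ∀ y ∈ V, v y = u y := by
  classical
  set A := V.filter fun x => u x ≠ v x with hA
  have hAΩ : ∀ x ∈ A, x ∈ V \ Ω := fun x hx => by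
    have := Finset.mem_filter.1 hx
    exact Finset.mem_sdiff.2 ⟨this.1, fun h => this.2 ((hu x h).trans (hv x h).symm)⟩
  by_contra hcon
  push Not at hcon
  obtain ⟨y₀, hy₀, hy₀ne⟩ := hcon
  have hA0 : A.Nonempty := ⟨y₀, Finset.mem_filter.2 ⟨hy₀, hy₀ne.symm⟩⟩
  obtain ⟨b, hbA, hbmax⟩ := A.exists_max_image (locLip V Adj u) hA0
  set M := locLip V Adj u b with hM
  have hMpos : 0 < M := by
    refine lt_of_le_of_ne locLip_nonneg fun h0 => ?_
    obtain ⟨z, hz⟩ := hΩ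
    have hreach : ∀ c, Relation.ReflTransGen (fun a b => a ∈ V ∧ b ∈ V ∧ Adj a b) b c →
        c ∈ A := by
      intro c hbc
      induction hbc with
      | refl => exact hbA
      | @tail a c _ hac haA =>
        obtain ⟨-, hc, hadj⟩ := hac
        have hconst : ∀ g : EuclideanSpace ℝ (Fin n) → EuclideanSpace ℝ (Fin m),
            locLip V Adj g a ≤ 0 → g c = g a := fun g hg => by
          have h1 := (slope_le_locLip (v := g) hc hadj).trans hg
          rw [div_le_iff₀ (norm_pos_iff.2 (sub_ne_zero.2 (hne _ _ hadj).symm)), zero_mul] at h1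
          exact sub_eq_zero.1 (norm_le_zero_iff.1 h1)
        have hua : locLip V Adj u a ≤ 0 := h0 ▸ hbmax a haA
        have hva : locLip V Adj v a ≤ 0 := huv a (hAΩ a haA) ▸ hua
        refine Finset.mem_filter.2 ⟨hc, ?_⟩
        rw [hconst u hua, hconst v hva]
        exact (Finset.mem_filter.1 haA).2
    have hzA := hreach z (hconn b (Finset.mem_filter.1 hbA).1 z (hΩV hz))
    exact (Finset.mem_sdiff.1 (hAΩ z hzA)).2 hz
  set B := A.filter fun x => locLip V Adj u x = M with hB
  set w : EuclideanSpace ℝ (Fin n) → EuclideanSpace ℝ (Fin m) :=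
    fun z => midpoint ℝ (u z) (v z) with hw
  set wε : ℝ → EuclideanSpace ℝ (Fin n) → EuclideanSpace ℝ (Fin m) :=
    fun ε z => if z ∈ B then (1 - ε) • w z else w z with hwε
  have hwε0 : wε 0 = w := by ext1 z; simp [hwε]
  have hcont : ∀ x y, Continuous fun ε => ‖wε ε y - wε ε x‖ / ‖y - x‖ := by
    intro x y
    have h : ∀ z, Continuous fun ε => wε ε z := fun z => by
      by_cases hz : z ∈ B
      · simp only [hwε, if_pos hz]; fun_prop
      · simp only [hwε, if_neg hz]; fun_prop
    exact ((h y).sub (h x)).norm.div_const _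
  have hev : ∀ x y, ‖w y - w x‖ / ‖y - x‖ < M →
      ∀ᶠ ε in 𝓝[>] (0 : ℝ), ‖wε ε y - wε ε x‖ / ‖y - x‖ < M := fun x y h =>
    ((hcont x y).continuousAt.eventually_lt continuousAt_const
      (by rw [hwε0]; exact h)).filter_mono nhdsWithin_le_nhds
  have hslope : ∀ x ∈ V \ Ω, ∀ y ∈ V, Adj x y → ‖u y - u x‖ / ‖y - x‖ ≤ locLip V Adj u x ∧
      ‖v y - v x‖ / ‖y - x‖ ≤ locLip V Adj u x := fun x hx y hy hxy =>
    ⟨slope_le_locLip hy hxy, huv x hx ▸ slope_le_locLip hy hxy⟩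
  have hBmem : ∀ x ∈ A, M ≤ locLip V Adj u x → x ∈ B := fun x hx h =>
    Finset.mem_filter.2 ⟨hx, le_antisymm (hbmax x hx) h⟩
  have hedge : ∀ x ∈ V \ Ω, ∀ y ∈ V, ∀ᶠ ε in 𝓝[>] (0 : ℝ), Adj x y →
      ‖wε ε y - wε ε x‖ / ‖y - x‖ < M ∨ (M ≤ locLip V Adj u x ∧ x ∉ B ∧
        ‖wε ε y - wε ε x‖ / ‖y - x‖ ≤ locLip V Adj u x) := by
    intro x hx y hy
    by_cases hxy : Adj x y
    swap
    · exact Eventually.of_forall fun ε h => absurd h hxy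
    obtain ⟨h1, h2⟩ := hslope x hx y hy hxy
    have hmid : ‖w y - w x‖ / ‖y - x‖ ≤ locLip V Adj u x :=
      slope_midpoint_le.trans (by linarith)
    by_cases hwM : ‖w y - w x‖ / ‖y - x‖ < M
    · exact (hev x y hwM).mono fun ε h _ => Or.inl h
    have hMx : M ≤ locLip V Adj u x := (not_lt.1 hwM).trans hmid
    by_cases hxB : x ∈ B
    · have hxA := (Finset.mem_filter.1 hxB).1
      have hxM := (Finset.mem_filter.1 hxB).2
      rw [hxM] at h1 h2 hmid
      have hd : u y - u x = v y - v x := by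
        by_contra hd
        exact hwM (slope_midpoint_lt (hne _ _ hxy) h1 h2 hd)
      have hyA : y ∈ A := by
        refine Finset.mem_filter.2 ⟨hy, fun h => (Finset.mem_filter.1 hxA).2 ?_⟩
        rw [h] at hd
        exact sub_right_injective hd
      have hyB : y ∈ B := by
        refine hBmem y hyA ((not_lt.1 hwM).trans ?_)
        have h3 := hslope y (hAΩ y hyA) x (Finset.mem_filter.1 hxA).1 (hsymm _ _ hxy)
        rw [norm_sub_rev, norm_sub_rev x, norm_sub_rev (v x)] at h3
        exact slope_midpoint_le.trans (by linarith [h3.1, h3.2])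
      filter_upwards [Ioc_mem_nhdsGT (zero_lt_one (α := ℝ))] with ε hε _
      left
      have : wε ε y - wε ε x = (1 - ε) • (w y - w x) := by
        simp only [hwε, if_pos hyB, if_pos hxB, smul_sub]
      rw [this, norm_smul, mul_div_assoc, Real.norm_of_nonneg (by linarith [hε.2])]
      nlinarith [hε.1, hε.2]
    · by_cases hyB : y ∈ B
      · have hyA := (Finset.mem_filter.1 hyB).1
        have hyM := (Finset.mem_filter.1 hyB).2
        have hxA : x ∉ A := fun h => hxB (hBmem x h hMx)
        have hxeq : u x = v x := by
          by_contra h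
          exact hxA (Finset.mem_filter.2 ⟨(Finset.mem_sdiff.1 hx).1, h⟩)
        have h3 := hslope y (hAΩ y hyA) x (Finset.mem_sdiff.1 hx).1 (hsymm _ _ hxy)
        rw [hyM, norm_sub_rev, norm_sub_rev x, norm_sub_rev (v x)] at h3
        refine absurd (slope_midpoint_lt (hne _ _ hxy) h3.1 h3.2 fun h => ?_) hwM
        rw [hxeq] at h
        exact (Finset.mem_filter.1 hyA).2 (sub_left_injective h)
      · refine Eventually.of_forall fun ε _ => Or.inr ⟨hMx, hxB, ?_⟩
        simpa only [hwε, if_neg hyB, if_neg hxB] using hmid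
  obtain ⟨ε, hε⟩ := ((Filter.eventually_all_finset (V \ Ω)).2 fun x hx =>
    (Filter.eventually_all_finset V).2 fun y hy => hedge x hx y hy).exists
  have hbB : b ∈ B := Finset.mem_filter.2 ⟨hbA, rfl⟩
  have hBlt : ∀ x ∈ B, locLip V Adj (wε ε) x < M := fun x hx => locLip_lt hMpos fun y hy hxy =>
    (hε x (hAΩ x (Finset.mem_filter.1 hx).1) y hy hxy).resolve_right fun h => h.2.1 hx
  refine hmin (wε ε) (fun z hz => ?_) ⟨M, fun x hx hMx => ?_, fun x hx hMx => ?_, b, hAΩ b hbA,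
    le_rfl, hBlt b hbB⟩
  · have hzB : z ∉ B := fun h =>
      (Finset.mem_sdiff.1 (hAΩ z (Finset.mem_filter.1 h).1)).2 hz
    simp only [hwε, if_neg hzB, hw, hu z hz, hv z hz, midpoint_self]
  · exact locLip_le (hMpos.le.trans hMx) fun y hy hxy =>
      (hε x hx y hy hxy).elim (fun h => h.le.trans hMx) fun h => h.2.2
  · exact locLip_lt hMpos fun y hy hxy =>
      (hε x hx y hy hxy).resolve_right fun h => absurd h.1 (not_le.2 hMx)

lemma le_sSup_locLip (hx : x ∈ V \ Ω) (h : locLip V Adj v x < locLip V Adj u x) :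
    locLip V Adj u x ≤ sSup {r : ℝ | ∃ x ∈ V, x ∉ Ω ∧
      locLip V Adj v x < locLip V Adj u x ∧ r = locLip V Adj u x} := by
  refine le_csSup ((V.finite_toSet.image (locLip V Adj u)).subset ?_).bddAbove
    ⟨x, (Finset.mem_sdiff.1 hx).1, (Finset.mem_sdiff.1 hx).2, h, rfl⟩
  rintro r ⟨y, hy, -, -, rfl⟩
  exact ⟨y, hy, rfl⟩

/-- If `u` is not tighter than `v` and admits no improvement, then `u` and `v` have the same local
Lipschitz constants. -/
lemma locLip_eq_of_not_tighter (hu : ∀ z ∈ Ω, u z = f z) (hv : ∀ z ∈ Ω, v z = f z)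
    (hmin : ∀ w : EuclideanSpace ℝ (Fin n) → EuclideanSpace ℝ (Fin m), (∀ z ∈ Ω, w z = f z) →
      ¬ Improves (V \ Ω) (locLip V Adj w) (locLip V Adj u))
    (h : ¬ Tighter V Ω Adj u v) : ∀ x ∈ V \ Ω, locLip V Adj u x = locLip V Adj v x := by
  by_contra hcon
  push Not at hcon
  obtain ⟨x₁, hx₁, hne₁⟩ := hcon
  set Su := {r : ℝ | ∃ x ∈ V, x ∉ Ω ∧ locLip V Adj v x < locLip V Adj u x ∧
    r = locLip V Adj u x} with hSu
  have hle := not_lt.1 h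
  have hfin : Su.Finite := (V.finite_toSet.image (locLip V Adj u)).subset (by
    rintro r ⟨y, hy, -, -, rfl⟩
    exact ⟨y, hy, rfl⟩)
  have hSu0 : Su.Nonempty := by
    by_contra h0
    rw [Set.not_nonempty_iff_eq_empty] at h0
    rw [← hSu, h0, Real.sSup_empty] at hle
    rcases lt_or_gt_of_ne hne₁ with h1 | h1
    · linarith [le_sSup_locLip hx₁ h1, locLip_nonneg (V := V) (Adj := Adj) (v := u) (x := x₁)]
    · exact h0.subset ⟨x₁, (Finset.mem_sdiff.1 hx₁).1, (Finset.mem_sdiff.1 hx₁).2, h1, rfl⟩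
  obtain ⟨x₀, hx₀, hx₀', hlt, hM⟩ := hSu0.csSup_mem hfin
  have hcomp : ∀ x ∈ V \ Ω, locLip V Adj u x < locLip V Adj v x →
      locLip V Adj v x ≤ locLip V Adj u x₀ := fun x hx hx' =>
    (le_sSup_locLip hx hx').trans (hle.trans hM.le)
  refine hmin (fun z => midpoint ℝ (u z) (v z)) (fun z hz => by
    rw [hu z hz, hv z hz, midpoint_self]) ⟨locLip V Adj u x₀, fun x hx hMx => ?_,
    fun x hx hMx => ?_, x₀, Finset.mem_sdiff.2 ⟨hx₀, hx₀'⟩, le_rfl, ?_⟩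
  · refine locLip_midpoint_le.trans ?_
    rcases lt_or_ge (locLip V Adj u x) (locLip V Adj v x) with h1 | h1
    · linarith [hcomp x hx h1]
    · linarith
  · refine locLip_midpoint_le.trans_lt ?_
    rcases lt_or_ge (locLip V Adj u x) (locLip V Adj v x) with h1 | h1
    · linarith [hcomp x hx h1]
    · linarith
  · exact locLip_midpoint_le.trans_lt (by linarith)

end LocLip

/-- Sheffield–Smart: on a finite connected graph `G = (V, E, Ω)` with
`V ⊆ ℝⁿ`, adjacent vertices distinct, and `Ω ⊆ V` nonempty, every `f : Ω → ℝᵐ` has a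
unique tight extension `u`; moreover `u` is tighter than every other extension `v ≠ u`. -/
theorem exists_unique_tight_extension (n m : ℕ)
    (V : Finset (EuclideanSpace ℝ (Fin n)))
    (Adj : EuclideanSpace ℝ (Fin n) → EuclideanSpace ℝ (Fin n) → Prop)
    (hsymm : ∀ x y, Adj x y → Adj y x)
    (hne : ∀ x y, Adj x y → x ≠ y)
    (hconn : ∀ x ∈ V, ∀ y ∈ V,
      Relation.ReflTransGen (fun a b => a ∈ V ∧ b ∈ V ∧ Adj a b) x y)
    (Ω : Finset (EuclideanSpace ℝ (Fin n))) (hΩ : Ω.Nonempty) (hΩV : Ω ⊆ V)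
    (f : EuclideanSpace ℝ (Fin n) → EuclideanSpace ℝ (Fin m)) :
    ∃ u : EuclideanSpace ℝ (Fin n) → EuclideanSpace ℝ (Fin m),
      -- u is a tight extension of f
      ((∀ z ∈ Ω, u z = f z) ∧
        ¬ ∃ v : EuclideanSpace ℝ (Fin n) → EuclideanSpace ℝ (Fin m),
            (∀ z ∈ Ω, v z = f z) ∧ Tighter V Ω Adj v u) ∧
      -- u is tighter than every other extension of f
      (∀ v : EuclideanSpace ℝ (Fin n) → EuclideanSpace ℝ (Fin m),
        (∀ z ∈ Ω, v z = f z) → (∃ y ∈ V, v y ≠ u y) → Tighter V Ω Adj u v) ∧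
      -- uniqueness (as functions on V)
      (∀ u' : EuclideanSpace ℝ (Fin n) → EuclideanSpace ℝ (Fin m),
        (∀ z ∈ Ω, u' z = f z) →
        (¬ ∃ v : EuclideanSpace ℝ (Fin n) → EuclideanSpace ℝ (Fin m),
            (∀ z ∈ Ω, v z = f z) ∧ Tighter V Ω Adj v u') →
        ∀ y ∈ V, u' y = u y) := by
  obtain ⟨u, hu, hmin⟩ := exists_extension_not_improves hsymm hne hconn hΩ hΩV f
  have key : ∀ v : EuclideanSpace ℝ (Fin n) → EuclideanSpace ℝ (Fin m), (∀ z ∈ Ω, v z = f z) →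
      ¬ Tighter V Ω Adj u v → ∀ y ∈ V, v y = u y := fun v hv hnt =>
    eq_of_locLip_eq hsymm hne hconn hΩ hΩV hu hv hmin (locLip_eq_of_not_tighter hu hv hmin hnt)
  refine ⟨u, ⟨hu, ?_⟩, ?_, ?_⟩
  · rintro ⟨v, hv, ht⟩
    have heq := locLip_eq_of_not_tighter hu hv hmin (not_lt.2 (le_of_lt ht))
    refine lt_irrefl (0 : ℝ) ?_
    have hempty : ∀ a b : EuclideanSpace ℝ (Fin n) → EuclideanSpace ℝ (Fin m),
        (∀ x ∈ V \ Ω, locLip V Adj a x = locLip V Adj b x) → {r : ℝ | ∃ x ∈ V, x ∉ Ω ∧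
          locLip V Adj a x < locLip V Adj b x ∧ r = locLip V Adj b x} = ∅ := by
      intro a b hab
      refine Set.eq_empty_of_forall_notMem ?_
      rintro r ⟨x, hx, hx', hlt, -⟩
      exact hlt.ne (hab x (Finset.mem_sdiff.2 ⟨hx, hx'⟩))
    rw [Tighter, hempty u v heq, hempty v u fun x hx => (heq x hx).symm, Real.sSup_empty] at ht
    exact ht
  · rintro v hv ⟨y, hy, hne'⟩
    by_contra hnt
    exact hne' (key v hv hnt y hy)
  · exact fun u' hu' ht => key u' hu' fun h => ht ⟨u, hu, h⟩
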